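/- Under the AOD algorithm with horizon T (losses valued in [0,1], convex, G-Lipschitz gradients, domain diameter at most D), let u_1,…,u_T ∈ Ω be any comparator sequence with path-length P_T = Σ_{t=1}^{T−1} ‖u_{t+1}−u_t‖₂, and suppose P_T ≤ D. Then Σ_{t=1}^T f_t(w_t) − Σ_{t=1}^T f_t(u_t) ≤ ( ((1+√2)/2)·DG + G·√(D·P_T) + √(6·c(T)) )·√T, where c(T) = 1 + ln T + ln(1 + log₂ T) + ln( (5 + 3 ln(1+T))/2 ). -/

import Mathlib

/-- The AdaNormalHedge potential `Φ(R,C) = exp([R]₊²/(3C))` (with `Φ(R,0) = 1`,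
matching `Φ(0,0) = 1`, since `x/0 = 0` in Lean). -/
noncomputable def anhPot (R C : ℝ) : ℝ := Real.exp (max R 0 ^ 2 / (3 * C))

/-- The AdaNormalHedge weight function `w(R,C) = (Φ(R+1,C+1) − Φ(R−1,C+1))/2`. -/
noncomputable def anhW (R C : ℝ) : ℝ := (anhPot (R + 1) (C + 1) - anhPot (R - 1) (C + 1)) / 2

/-- The starting round `(i−1)·2^k + 1` of the interval of the dense geometric covering
level `D_k` that contains round `t ≥ 1`. -/
def dgcStart (k t : ℕ) : ℕ := (t - 1) / 2 ^ k * 2 ^ k + 1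

/-- The levels `k` with `2^k ≤ T` of the dense geometric covering collection
`D = ∪_{k ≥ 0, 2^k ≤ T} D_k`, `D_k = {[(i−1)·2^k + 1, i·2^k] : i ≥ 1}`.  At every round
exactly one interval of each level is active, so experts are indexed by levels. -/
def dgcLevels (T : ℕ) : Finset ℕ := (Finset.range (T + 1)).filter fun k => 2 ^ k ≤ T

/-- `R_{t−1,I} = Σ_{u=min I}^{t−1} (f_u(w_u) − f_u(w_{u,I}))` for the active level-`k`
expert at round `t` (whose interval starts at `dgcStart k t`); `x k u` is the action of
the level-`k` expert at round `u`. -/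
noncomputable def aodMetaR {α : Type*} (f : ℕ → α → ℝ) (w : ℕ → α) (x : ℕ → ℕ → α)
    (k t : ℕ) : ℝ :=
  ∑ u ∈ Finset.Icc (dgcStart k t) (t - 1), (f u (w u) - f u (x k u))

/-- `C_{t−1,I} = Σ_{u=min I}^{t−1} |f_u(w_u) − f_u(w_{u,I})|` for the active level-`k`
expert at round `t`. -/
noncomputable def aodMetaC {α : Type*} (f : ℕ → α → ℝ) (w : ℕ → α) (x : ℕ → ℕ → α)
    (k t : ℕ) : ℝ :=
  ∑ u ∈ Finset.Icc (dgcStart k t) (t - 1), |f u (w u) - f u (x k u)|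

/-- The AdaNormalHedge weight `p_{t,I}` that AOD assigns to the active level-`k`
expert at round `t`. -/
noncomputable def aodWeight {α : Type*} (T : ℕ) (f : ℕ → α → ℝ) (w : ℕ → α)
    (x : ℕ → ℕ → α) (k t : ℕ) : ℝ :=
  anhW (aodMetaR f w x k t) (aodMetaC f w x k t) /
    ∑ k' ∈ dgcLevels T, anhW (aodMetaR f w x k' t) (aodMetaC f w x k' t)

/-- `c(t) = 1 + ln t + ln(1 + log₂ T) + ln((5 + 3 ln(1+t))/2)`. -/
noncomputable def cAOD (T t : ℕ) : ℝ :=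
  1 + Real.log t + Real.log (1 + Real.logb 2 T) + Real.log ((5 + 3 * Real.log (1 + (t : ℝ))) / 2)

/-! ### The AdaNormalHedge potential -/

theorem one_le_anhPot (R : ℝ) {C : ℝ} (hC : 0 ≤ C) : 1 ≤ anhPot R C :=
  Real.one_le_exp (by positivity)

theorem anhPot_mono {R R' C : ℝ} (h : R ≤ R') (hC : 0 ≤ C) : anhPot R C ≤ anhPot R' C := by
  unfold anhPot
  gcongr

theorem anhW_nonneg (R : ℝ) {C : ℝ} (hC : 0 ≤ C) : 0 ≤ anhW R C := by
  have := anhPot_mono (show R - 1 ≤ R + 1 by linarith) (show 0 ≤ C + 1 by linarith)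
  unfold anhW
  linarith

theorem anhW_zero_zero_pos : 0 < anhW 0 0 := by
  have : Real.exp 0 < Real.exp (1 / 3) := Real.exp_lt_exp.2 (by norm_num)
  norm_num [anhW, anhPot] at this ⊢

/-- Joint convexity of `(a, c) ↦ a² / (3c)`, with `0² / 0 = 0` at the origin. -/
theorem sq_div_three_mul_convex {a₀ a₁ c₀ c₁ l : ℝ} (h₀ : 0 ≤ a₀)
    (hc₀ : a₀ ≤ c₀) (hc₁ : 0 < c₁) (hl₀ : 0 ≤ l) (hl₁ : l ≤ 1) :
    ((1 - l) * a₀ + l * a₁) ^ 2 / (3 * ((1 - l) * c₀ + l * c₁)) ≤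
      (1 - l) * (a₀ ^ 2 / (3 * c₀)) + l * (a₁ ^ 2 / (3 * c₁)) := by
  have hl : 0 ≤ 1 - l := by linarith
  have hc₀' : 0 ≤ c₀ := h₀.trans hc₀
  obtain ⟨q₀, hq₀⟩ : ∃ q, q = a₀ ^ 2 / (3 * c₀) := ⟨_, rfl⟩
  obtain ⟨q₁, hq₁⟩ : ∃ q, q = a₁ ^ 2 / (3 * c₁) := ⟨_, rfl⟩
  have hq₀' : 0 ≤ q₀ := hq₀ ▸ by positivity
  have hq₁' : 0 ≤ q₁ := hq₁ ▸ by positivity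
  have e₀ : a₀ ^ 2 = 3 * c₀ * q₀ := by
    rcases hc₀'.eq_or_lt with h | h
    · have : a₀ = 0 := by linarith
      simp [this, ← h]
    · rw [hq₀]; field_simp
  have e₁ : a₁ ^ 2 = 3 * c₁ * q₁ := by rw [hq₁]; field_simp
  rw [← hq₀, ← hq₁]
  have cross : 2 * (a₀ * a₁) ≤ 3 * (c₀ * q₁ + c₁ * q₀) := by
    refine abs_le_of_sq_le_sq' ?_ (by positivity) |>.2
    calc (2 * (a₀ * a₁)) ^ 2 = 36 * ((c₀ * q₁) * (c₁ * q₀)) := by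
          rw [mul_pow, mul_pow, e₀, e₁]; ring
      _ ≤ (3 * (c₀ * q₁ + c₁ * q₀)) ^ 2 := by nlinarith [sq_nonneg (c₀ * q₁ - c₁ * q₀)]
  refine div_le_of_le_mul₀ (by positivity) (by positivity) ?_
  have := mul_le_mul_of_nonneg_left cross (mul_nonneg hl hl₀)
  calc ((1 - l) * a₀ + l * a₁) ^ 2
      = (1 - l) ^ 2 * a₀ ^ 2 + l ^ 2 * a₁ ^ 2 + (1 - l) * l * (2 * (a₀ * a₁)) := by ring
    _ ≤ (1 - l) ^ 2 * a₀ ^ 2 + l ^ 2 * a₁ ^ 2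
          + (1 - l) * l * (3 * (c₀ * q₁ + c₁ * q₀)) := by linarith
    _ = _ := by rw [e₀, e₁]; ring

theorem anhPot_convex {R₀ R₁ C₀ C₁ l : ℝ} (h₀ : |R₀| ≤ C₀) (h₁ : 0 < C₁)
    (hl₀ : 0 ≤ l) (hl₁ : l ≤ 1) :
    anhPot ((1 - l) * R₀ + l * R₁) ((1 - l) * C₀ + l * C₁) ≤
      (1 - l) * anhPot R₀ C₀ + l * anhPot R₁ C₁ := by
  have hl : 0 ≤ 1 - l := by linarith
  have hC₀ : 0 ≤ C₀ := (abs_nonneg _).trans h₀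
  have hmax : max ((1 - l) * R₀ + l * R₁) 0 ≤ (1 - l) * max R₀ 0 + l * max R₁ 0 := by
    refine max_le ?_ (by positivity)
    gcongr <;> exact le_max_left _ _
  refine (Real.exp_le_exp.2 ?_).trans
    (convexOn_exp.2 (Set.mem_univ _) (Set.mem_univ _) hl hl₀ (by ring))
  refine le_trans ?_ (sq_div_three_mul_convex (le_max_right R₀ 0)
    (max_le ((le_abs_self _).trans h₀) hC₀) h₁ hl₀ hl₁)
  gcongr

theorem anhPot_average_le {R C : ℝ} (h : |R| ≤ C) :
    (anhPot (R + 1) (C + 1) + anhPot (R - 1) (C + 1)) / 2 ≤ anhPot R C + 3 := by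
  have hRC := (abs_le.1 h).2
  have hC : 0 ≤ C := (abs_nonneg _).trans h
  have hone := one_le_anhPot R hC
  have hexp : Real.exp (4 / 3) ≤ 4 := by
    have h1 : Real.exp (4 / 3) ^ 3 ≤ 4 ^ 3 := by
      rw [← Real.exp_nat_mul]
      have : Real.exp (((3 : ℕ) : ℝ) * (4 / 3)) = Real.exp 1 ^ 4 := by
        rw [← Real.exp_nat_mul]; norm_num
      rw [this]
      calc Real.exp 1 ^ 4 ≤ 2.7182818286 ^ 4 := by
            gcongr; exact Real.exp_one_lt_d9.le
        _ ≤ 4 ^ 3 := by norm_num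
    exact le_of_pow_le_pow_left₀ (by norm_num) (by norm_num) h1
  rcases lt_or_ge R 1 with hR | hR
  · have h2 : anhPot (R - 1) (C + 1) = 1 := by
      rw [anhPot, max_eq_right (by linarith)]; simp
    have h3 : anhPot (R + 1) (C + 1) ≤ 4 := by
      refine (Real.exp_le_exp.2 ?_).trans hexp
      rw [div_le_iff₀ (by positivity)]
      have h4 : max (R + 1) 0 ≤ 2 := max_le (by linarith) (by norm_num)
      have h5 : max (R + 1) 0 ≤ C + 1 := max_le (by linarith) (by linarith)
      have h6 := le_max_right (R + 1) 0
      nlinarith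
    linarith
  · have hC1 : 1 ≤ C := hR.trans hRC
    set A : ℝ := (R ^ 2 + 1) / (3 * (C + 1)) with hA
    set B : ℝ := 2 * R / (3 * (C + 1)) with hB
    have e1 : anhPot (R + 1) (C + 1) = Real.exp (A + B) := by
      rw [anhPot, max_eq_left (by linarith), hA, hB, ← add_div]; ring_nf
    have e2 : anhPot (R - 1) (C + 1) = Real.exp (A - B) := by
      rw [anhPot, max_eq_left (by linarith), hA, hB, ← sub_div]; ring_nf
    have e3 : anhPot R C = Real.exp (R ^ 2 / (3 * C)) := by
      rw [anhPot, max_eq_left (by linarith)]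
    have havg : (anhPot (R + 1) (C + 1) + anhPot (R - 1) (C + 1)) / 2
        ≤ Real.exp (A + B ^ 2 / 2) := by
      calc _ = Real.exp A * Real.cosh B := by
            rw [e1, e2, Real.cosh_eq, sub_eq_add_neg, Real.exp_add, Real.exp_add]; ring
        _ ≤ Real.exp A * Real.exp (B ^ 2 / 2) := by
            gcongr; exact Real.cosh_le_exp_half_sq B
        _ = _ := (Real.exp_add _ _).symm
    have hgap : A + B ^ 2 / 2 = R ^ 2 / (3 * C)
        + (3 * C * (C + 1) - R ^ 2 * (C + 3)) / (9 * C * (C + 1) ^ 2) := by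
      rw [hA, hB]; field_simp; ring
    rcases le_total (3 * C * (C + 1)) (R ^ 2 * (C + 3)) with hc | hc
    · have : (3 * C * (C + 1) - R ^ 2 * (C + 3)) / (9 * C * (C + 1) ^ 2) ≤ 0 :=
        div_nonpos_of_nonpos_of_nonneg (by linarith) (by positivity)
      have : Real.exp (A + B ^ 2 / 2) ≤ anhPot R C := by
        rw [e3]; exact Real.exp_le_exp.2 (by linarith)
      linarith
    · have h1 : R ^ 2 / (3 * C) ≤ 1 := by
        rw [div_le_one (by positivity)]
        have : 0 ≤ R ^ 2 := sq_nonneg R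
        by_contra! hcon
        nlinarith [mul_lt_mul_of_pos_right hcon (show 0 < C + 3 by linarith)]
      have h2 : (3 * C * (C + 1) - R ^ 2 * (C + 3)) / (9 * C * (C + 1) ^ 2) ≤ 1 / 3 := by
        rw [div_le_iff₀ (by positivity)]
        have : 0 ≤ R ^ 2 * (C + 3) := by positivity
        nlinarith [mul_nonneg hC hC, mul_nonneg hC (mul_nonneg hC hC)]
      have : Real.exp (A + B ^ 2 / 2) ≤ 4 :=
        (Real.exp_le_exp.2 (by linarith)).trans hexp
      linarith

/-- One round of AdaNormalHedge increases the potential by at most a constant beyond the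
weighted instantaneous regret. -/
theorem anhPot_step {R C r : ℝ} (h : |R| ≤ C) (hr : |r| ≤ 1) :
    anhPot (R + r) (C + |r|) ≤ anhPot R C + anhW R C * r + 3 := by
  have hC : 0 ≤ C := (abs_nonneg _).trans h
  have havg := anhPot_average_le h
  have hW : anhW R C = (anhPot (R + 1) (C + 1) - anhPot (R - 1) (C + 1)) / 2 := rfl
  rcases le_total 0 r with h0 | h0
  · rw [abs_of_nonneg h0] at hr ⊢
    have := anhPot_convex (R₁ := R + 1) h (show 0 < C + 1 by linarith) h0 hr
    rw [show (1 - r) * R + r * (R + 1) = R + r by ring,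
      show (1 - r) * C + r * (C + 1) = C + r by ring] at this
    nlinarith
  · rw [abs_of_nonpos h0] at hr ⊢
    have := anhPot_convex (R₁ := R - 1) h (show 0 < C + 1 by linarith) (neg_nonneg.2 h0) hr
    rw [show (1 - -r) * R + -r * (R - 1) = R + r by ring,
      show (1 - -r) * C + -r * (C + 1) = C + -r by ring] at this
    nlinarith

/-- A bound on the potential bounds the regret. -/
theorem le_sqrt_of_anhPot_le {R C c : ℝ} (h : |R| ≤ C) (hp : anhPot R C ≤ Real.exp c) :
    R ≤ √(3 * C * c) := by
  have hC : 0 ≤ C := (abs_nonneg _).trans h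
  have h1 : max R 0 ^ 2 / (3 * C) ≤ c := Real.exp_le_exp.1 hp
  refine (le_max_left R 0).trans (Real.le_sqrt_of_sq_le ?_)
  rcases hC.eq_or_lt with h0 | h0
  · have : R = 0 := abs_nonpos_iff.1 (h0 ▸ h)
    simp [this, ← h0]
  · rwa [div_le_iff₀' (by positivity)] at h1

/-! ### Regret of the meta-algorithm against an expert on its interval -/

theorem dgcStart_le {k t : ℕ} (ht : 1 ≤ t) : dgcStart k t ≤ t := by
  have := Nat.div_mul_le_self (t - 1) (2 ^ k)
  unfold dgcStart
  omega

theorem one_le_dgcStart (k t : ℕ) : 1 ≤ dgcStart k t := by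
  unfold dgcStart
  omega

theorem dgcStart_zero {t : ℕ} (ht : 1 ≤ t) : dgcStart 0 t = t := by
  simp [dgcStart, ht]

theorem dgcStart_succ (k : ℕ) {t : ℕ} (ht : 1 ≤ t) :
    dgcStart k (t + 1) = dgcStart k t ∨ dgcStart k (t + 1) = t + 1 := by
  obtain ⟨n, rfl⟩ := Nat.exists_eq_add_of_le' ht
  unfold dgcStart
  simp only [Nat.add_sub_cancel]
  by_cases h : 2 ^ k ∣ n + 1
  · right
    rw [Nat.div_mul_cancel h]
  · left
    rw [Nat.succ_div_of_not_dvd h]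

section Meta

variable {α : Type*} (f : ℕ → α → ℝ) (w : ℕ → α) (x : ℕ → ℕ → α)

theorem abs_aodMetaR_le (k t : ℕ) : |aodMetaR f w x k t| ≤ aodMetaC f w x k t :=
  Finset.abs_sum_le_sum_abs _ _

theorem aodMetaC_nonneg (k t : ℕ) : 0 ≤ aodMetaC f w x k t :=
  (abs_nonneg _).trans (abs_aodMetaR_le f w x k t)

theorem sum_Icc_dgcStart (g : ℕ → ℝ) (k : ℕ) {t : ℕ} (ht : 1 ≤ t) :
    ∑ u ∈ Finset.Icc (dgcStart k t) t, g u =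
      ∑ u ∈ Finset.Icc (dgcStart k t) (t - 1), g u + g t := by
  obtain ⟨n, rfl⟩ := Nat.exists_eq_add_of_le' ht
  rw [Nat.add_sub_cancel, Finset.sum_Icc_succ_top (dgcStart_le ht)]

/-- Passing to the next round, an expert either continues or is restarted with the smallest
possible potential. -/
theorem anhPot_succ_le (k : ℕ) {t : ℕ} (ht : 1 ≤ t) :
    anhPot (aodMetaR f w x k (t + 1)) (aodMetaC f w x k (t + 1)) ≤
      anhPot (∑ u ∈ Finset.Icc (dgcStart k t) t, (f u (w u) - f u (x k u)))
        (∑ u ∈ Finset.Icc (dgcStart k t) t, |f u (w u) - f u (x k u)|) := by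
  rcases dgcStart_succ k ht with h | h
  · simp [aodMetaR, aodMetaC, h]
  · refine le_trans (le_of_eq ?_) (one_le_anhPot _ (Finset.sum_nonneg fun _ _ => abs_nonneg _))
    simp [aodMetaR, aodMetaC, h, anhPot]

theorem sum_anhPot_le {T s : ℕ} (hs : 1 ≤ s)
    (hr : ∀ k t, 1 ≤ t → t ≤ s → |f t (w t) - f t (x k t)| ≤ 1)
    (hneg : ∀ t, 1 ≤ t → t ≤ s → ∑ k ∈ dgcLevels T,
      anhW (aodMetaR f w x k t) (aodMetaC f w x k t) * (f t (w t) - f t (x k t)) ≤ 0) :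
    ∑ k ∈ dgcLevels T,
      anhPot (∑ u ∈ Finset.Icc (dgcStart k s) s, (f u (w u) - f u (x k u)))
        (∑ u ∈ Finset.Icc (dgcStart k s) s, |f u (w u) - f u (x k u)|)
      ≤ (dgcLevels T).card * (1 + 3 * s) := by
  have step : ∀ t, 1 ≤ t → t ≤ s → ∑ k ∈ dgcLevels T,
      anhPot (∑ u ∈ Finset.Icc (dgcStart k t) t, (f u (w u) - f u (x k u)))
        (∑ u ∈ Finset.Icc (dgcStart k t) t, |f u (w u) - f u (x k u)|)
      ≤ ∑ k ∈ dgcLevels T, anhPot (aodMetaR f w x k t) (aodMetaC f w x k t)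
        + 3 * (dgcLevels T).card := by
    intro t ht hts
    have h1 : ∀ k ∈ dgcLevels T,
        anhPot (∑ u ∈ Finset.Icc (dgcStart k t) t, (f u (w u) - f u (x k u)))
          (∑ u ∈ Finset.Icc (dgcStart k t) t, |f u (w u) - f u (x k u)|)
        ≤ anhPot (aodMetaR f w x k t) (aodMetaC f w x k t)
          + anhW (aodMetaR f w x k t) (aodMetaC f w x k t) * (f t (w t) - f t (x k t)) + 3 := by
      intro k _
      rw [sum_Icc_dgcStart _ k ht, sum_Icc_dgcStart _ k ht]
      exact anhPot_step (abs_aodMetaR_le f w x k t) (hr k t ht hts)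
    refine (Finset.sum_le_sum h1).trans ?_
    rw [Finset.sum_add_distrib, Finset.sum_add_distrib, Finset.sum_const, nsmul_eq_mul]
    linarith [hneg t ht hts]
  induction s, hs using Nat.le_induction with
  | base =>
    refine (step 1 le_rfl le_rfl).trans (le_of_eq ?_)
    have : ∀ k, dgcStart k 1 = 1 := fun k => by simp [dgcStart]
    simp [aodMetaR, aodMetaC, anhPot, this]
    ring
  | succ n hn ih =>
    refine (step (n + 1) (by omega) le_rfl).trans ?_
    have h1 := ih (fun k t h h' => hr k t h (by omega)) (fun t h h' => hneg t h (by omega))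
      (fun t h h' => step t h (by omega))
    have h2 := Finset.sum_le_sum fun k (_ : k ∈ dgcLevels T) => anhPot_succ_le f w x k hn
    push_cast
    linarith

theorem card_dgcLevels_le (T : ℕ) :
    ((dgcLevels T).card : ℝ) ≤ 1 + Real.logb 2 T := by
  have h1 : dgcLevels T ⊆ Finset.range (Nat.log 2 T + 1) := by
    intro k hk
    have := (Finset.mem_filter.1 hk).2
    exact Finset.mem_range_succ_iff.2 (Nat.le_log_of_pow_le (by norm_num) this)
  have h2 := Finset.card_le_card h1
  rw [Finset.card_range] at h2
  have h3 : ((Nat.log 2 T : ℕ) : ℝ) ≤ Real.logb 2 T := by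
    simpa using Real.natLog_le_logb T 2
  have h4 : ((dgcLevels T).card : ℝ) ≤ Nat.log 2 T + 1 := by exact_mod_cast h2
  linarith

theorem card_dgcLevels_mul_le_exp_cAOD {T s : ℕ} (hT : 1 ≤ T) (hs : s ≤ T) :
    (dgcLevels T).card * (1 + 3 * (s : ℝ)) ≤ Real.exp (cAOD T T) := by
  have hT' : (1 : ℝ) ≤ T := by exact_mod_cast hT
  have hs' : (s : ℝ) ≤ T := by exact_mod_cast hs
  have hlog : 0 ≤ Real.log (1 + (T : ℝ)) := Real.log_nonneg (by linarith)
  have hlogb : 0 ≤ Real.logb 2 T := Real.logb_nonneg (by norm_num) hT'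
  unfold cAOD
  rw [Real.exp_add, Real.exp_add, Real.exp_add, Real.exp_log (by linarith),
    Real.exp_log (by linarith), Real.exp_log (by linarith)]
  calc (dgcLevels T).card * (1 + 3 * (s : ℝ)) ≤ (1 + Real.logb 2 T) * (4 * T) := by
        gcongr
        · exact card_dgcLevels_le T
        · linarith
    _ = 2 * T * (1 + Real.logb 2 T) * 2 := by ring
    _ ≤ _ := by
        gcongr
        · linarith [Real.exp_one_gt_d9]
        · linarith

theorem sum_sub_le_sqrt_cAOD {T s : ℕ} (hs : 1 ≤ s) (hsT : s ≤ T)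
    (hr : ∀ k t, 1 ≤ t → t ≤ s → |f t (w t) - f t (x k t)| ≤ 1)
    (hneg : ∀ t, 1 ≤ t → t ≤ s → ∑ k ∈ dgcLevels T,
      anhW (aodMetaR f w x k t) (aodMetaC f w x k t) * (f t (w t) - f t (x k t)) ≤ 0)
    {k : ℕ} (hk : k ∈ dgcLevels T) (hc : 0 ≤ cAOD T T) :
    ∑ u ∈ Finset.Icc (dgcStart k s) s, (f u (w u) - f u (x k u))
      ≤ √(3 * (s + 1 - dgcStart k s) * cAOD T T) := by
  have h1 := sum_anhPot_le f w x hs hr hneg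
  have h2 := Finset.single_le_sum (f := fun k =>
      anhPot (∑ u ∈ Finset.Icc (dgcStart k s) s, (f u (w u) - f u (x k u)))
        (∑ u ∈ Finset.Icc (dgcStart k s) s, |f u (w u) - f u (x k u)|))
    (fun k _ => (Real.exp_pos _).le) hk
  have h3 := card_dgcLevels_mul_le_exp_cAOD (hs.trans hsT) hsT
  refine (le_sqrt_of_anhPot_le (Finset.abs_sum_le_sum_abs _ _)
    (h2.trans (h1.trans h3))).trans ?_
  gcongr
  calc ∑ u ∈ Finset.Icc (dgcStart k s) s, |f u (w u) - f u (x k u)|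
      ≤ ∑ u ∈ Finset.Icc (dgcStart k s) s, (1 : ℝ) := Finset.sum_le_sum fun u hu => by
        have := Finset.mem_Icc.1 hu
        exact hr k u ((one_le_dgcStart k s).trans this.1) this.2
    _ = s + 1 - dgcStart k s := by
        have := dgcStart_le (k := k) hs
        simp only [Finset.sum_const, Nat.card_Icc, nsmul_eq_mul, mul_one]
        rw [Nat.cast_sub (by omega)]
        push_cast
        ring

theorem cAOD_nonneg {T : ℕ} (hT : 1 ≤ T) : 0 ≤ cAOD T T := by
  have hT' : (1 : ℝ) ≤ T := by exact_mod_cast hT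
  have hlog : 0 ≤ Real.log (1 + (T : ℝ)) := Real.log_nonneg (by linarith)
  have hlogb : 0 ≤ Real.logb 2 T := Real.logb_nonneg (by norm_num) hT'
  have h1 := Real.log_nonneg hT'
  have h2 := Real.log_nonneg (show 1 ≤ 1 + Real.logb 2 T by linarith)
  have h3 := Real.log_nonneg (show 1 ≤ (5 + 3 * Real.log (1 + (T : ℝ))) / 2 by linarith)
  unfold cAOD
  linarith

/-- Over the whole horizon, the regret against the top-level expert is that on the at most two
top-level intervals. -/
theorem sum_sub_top_level_le {T : ℕ} (hT : 1 ≤ T)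
    (hr : ∀ k t, 1 ≤ t → t ≤ T → |f t (w t) - f t (x k t)| ≤ 1)
    (hneg : ∀ t, 1 ≤ t → t ≤ T → ∑ k ∈ dgcLevels T,
      anhW (aodMetaR f w x k t) (aodMetaC f w x k t) * (f t (w t) - f t (x k t)) ≤ 0) :
    ∑ t ∈ Finset.Icc 1 T, (f t (w t) - f t (x (Nat.log 2 T) t))
      ≤ √(6 * cAOD T T) * √T := by
  set K := Nat.log 2 T with hK
  have hc := cAOD_nonneg hT
  have hle : 2 ^ K ≤ T := Nat.pow_log_le_self 2 (by omega)
  have hlt : T < 2 ^ K * 2 := by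
    rw [← pow_succ]; exact Nat.lt_pow_succ_log_self (by norm_num) T
  have hpos : 1 ≤ 2 ^ K := Nat.one_le_two_pow
  have hmem : K ∈ dgcLevels T := Finset.mem_filter.2
    ⟨Finset.mem_range.2 (Nat.lt_succ_of_le (Nat.log_le_self 2 T)), hle⟩
  have hstart₁ : dgcStart K (2 ^ K) = 1 := by
    simp [dgcStart, Nat.div_eq_of_lt (show 2 ^ K - 1 < 2 ^ K by omega)]
  have hfirst := sum_sub_le_sqrt_cAOD f w x hpos hle (fun k t h h' => hr k t h (h'.trans hle))
    (fun t h h' => hneg t h (h'.trans hle)) hmem hc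
  rw [hstart₁] at hfirst
  have hleR : ((2 ^ K : ℕ) : ℝ) ≤ T := by exact_mod_cast hle
  have hsum : √(3 * ((2 ^ K : ℕ) : ℝ) * cAOD T T) + √(3 * ((T : ℝ) - (2 ^ K : ℕ)) * cAOD T T)
      ≤ √(6 * cAOD T T) * √T := by
    rw [← Real.sqrt_mul (by positivity)]
    have h1 : 0 ≤ 3 * ((2 ^ K : ℕ) : ℝ) * cAOD T T := by positivity
    have h2 : 0 ≤ 3 * ((T : ℝ) - (2 ^ K : ℕ)) * cAOD T T :=
      mul_nonneg (by linarith) hc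
    refine Real.le_sqrt_of_sq_le ?_
    nlinarith [Real.sq_sqrt h1, Real.sq_sqrt h2,
      sq_nonneg (√(3 * ((2 ^ K : ℕ) : ℝ) * cAOD T T)
        - √(3 * ((T : ℝ) - (2 ^ K : ℕ)) * cAOD T T))]
  have hsplit : ∑ t ∈ Finset.Icc 1 T, (f t (w t) - f t (x K t)) =
      ∑ t ∈ Finset.Icc 1 (2 ^ K), (f t (w t) - f t (x K t))
        + ∑ t ∈ Finset.Icc (2 ^ K + 1) T, (f t (w t) - f t (x K t)) := by
    rw [← Finset.sum_union]
    · congr 1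
      ext t
      simp only [Finset.mem_union, Finset.mem_Icc]
      omega
    · rw [Finset.disjoint_left]
      intro t
      simp only [Finset.mem_Icc]
      omega
  have hsecond : ∑ t ∈ Finset.Icc (2 ^ K + 1) T, (f t (w t) - f t (x K t))
      ≤ √(3 * ((T : ℝ) - (2 ^ K : ℕ)) * cAOD T T) := by
    rcases hle.eq_or_lt with h | h
    · rw [Finset.Icc_eq_empty (by omega), Finset.sum_empty]
      positivity
    · have hstart₂ : dgcStart K T = 2 ^ K + 1 := by
        have : (T - 1) / 2 ^ K = 1 := by
          apply Nat.div_eq_of_lt_le <;> omega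
        simp [dgcStart, this]
      have := sum_sub_le_sqrt_cAOD f w x hT le_rfl hr hneg hmem hc
      rw [hstart₂] at this
      refine this.trans (le_of_eq ?_)
      push_cast
      ring_nf
  have hfirst' : ∑ t ∈ Finset.Icc 1 (2 ^ K), (f t (w t) - f t (x K t))
      ≤ √(3 * ((2 ^ K : ℕ) : ℝ) * cAOD T T) := by
    refine hfirst.trans (le_of_eq ?_)
    push_cast
    ring_nf
  linarith

/-- The zeroth-level expert always has positive weight. -/
theorem sum_anhW_pos {T t : ℕ} (hT : 1 ≤ T) (ht : 1 ≤ t) :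
    0 < ∑ k ∈ dgcLevels T, anhW (aodMetaR f w x k t) (aodMetaC f w x k t) := by
  refine Finset.sum_pos' (fun k _ => anhW_nonneg _ (aodMetaC_nonneg f w x k t))
    ⟨0, Finset.mem_filter.2 ⟨by simp, by simpa using hT⟩, ?_⟩
  have h : Finset.Icc (dgcStart 0 t) (t - 1) = ∅ := by
    rw [dgcStart_zero ht]
    exact Finset.Icc_eq_empty (by omega)
  simpa [aodMetaR, aodMetaC, h] using anhW_zero_zero_pos

theorem aodWeight_nonneg (T k t : ℕ) : 0 ≤ aodWeight T f w x k t :=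
  div_nonneg (anhW_nonneg _ (aodMetaC_nonneg f w x k t))
    (Finset.sum_nonneg fun k _ => anhW_nonneg _ (aodMetaC_nonneg f w x k t))

theorem sum_aodWeight {T t : ℕ} (hT : 1 ≤ T) (ht : 1 ≤ t) :
    ∑ k ∈ dgcLevels T, aodWeight T f w x k t = 1 := by
  unfold aodWeight
  rw [← Finset.sum_div, div_self (sum_anhW_pos f w x hT ht).ne']

end Meta

/-- Jensen's inequality: the weighted average of the instantaneous regrets is nonpositive. -/
theorem sum_anhW_mul_nonpos {E : Type*} [AddCommGroup E] [Module ℝ E] {f : ℕ → E → ℝ}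
    {w : ℕ → E} {x : ℕ → ℕ → E} {T t : ℕ} (hT : 1 ≤ T) (ht : 1 ≤ t)
    (hf : ConvexOn ℝ Set.univ (f t))
    (hw : w t = ∑ k ∈ dgcLevels T, aodWeight T f w x k t • x k t) :
    ∑ k ∈ dgcLevels T,
      anhW (aodMetaR f w x k t) (aodMetaC f w x k t) * (f t (w t) - f t (x k t)) ≤ 0 := by
  have hW := sum_anhW_pos f w x hT ht
  have hJ : f t (w t) ≤ ∑ k ∈ dgcLevels T, aodWeight T f w x k t • f t (x k t) := by
    conv_lhs => rw [hw]
    exact hf.map_sum_le (fun k _ => aodWeight_nonneg f w x T k t) (sum_aodWeight f w x hT ht)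
      fun _ _ => Set.mem_univ _
  simp only [aodWeight, smul_eq_mul, div_mul_eq_mul_div] at hJ
  rw [← Finset.sum_div, le_div_iff₀' hW] at hJ
  simp only [mul_sub, Finset.sum_sub_distrib, ← Finset.sum_mul]
  linarith

/-! ### Dynamic regret of online gradient descent -/

section OnlineGradientDescent

variable {E : Type*} [NormedAddCommGroup E] [InnerProductSpace ℝ E]

/-- The first-order characterisation of convexity. -/
theorem ConvexOn.sub_le_inner_gradient [CompleteSpace E] {f : E → ℝ}
    (hf : ConvexOn ℝ Set.univ f) {y : E} (hd : DifferentiableAt ℝ f y) (z : E) :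
    f y - f z ≤ inner ℝ (gradient f y) (y - z) := by
  have hline : HasDerivAt (fun s : ℝ => f (AffineMap.lineMap y z s))
      (inner ℝ (gradient f y) (z - y)) 0 := by
    have h1 : HasFDerivAt f (InnerProductSpace.toDual ℝ E (gradient f y))
        (AffineMap.lineMap y z (0 : ℝ)) := by
      simpa using hd.hasGradientAt.hasFDerivAt
    simpa using! h1.comp_hasDerivAt (0 : ℝ) AffineMap.hasDerivAt_lineMap
  have hconv : ConvexOn ℝ Set.univ (fun s : ℝ => f (AffineMap.lineMap y z s)) := by
    simpa using! hf.comp_affineMap (AffineMap.lineMap y z : ℝ →ᵃ[ℝ] E)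
  have := hconv.le_slope_of_hasDerivAt (Set.mem_univ 0) (Set.mem_univ 1) one_pos hline
  simp only [slope, AffineMap.lineMap_apply_one, AffineMap.lineMap_apply_zero, sub_zero, inv_one,
    vsub_eq_sub, one_smul] at this
  rw [← neg_sub z y, inner_neg_right]
  linarith

theorem norm_sub_le_of_isNearest {S : Set E} (hS : Convex ℝ S) {p z v : E} (hp : p ∈ S)
    (hmin : ∀ z' ∈ S, ‖p - z‖ ≤ ‖z' - z‖) (hv : v ∈ S) : ‖p - v‖ ≤ ‖z - v‖ := by
  have hinf : ‖z - p‖ = ⨅ w : S, ‖z - w‖ := by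
    have : Nonempty S := ⟨⟨p, hp⟩⟩
    refine le_antisymm (le_ciInf fun w => ?_)
      (ciInf_le ⟨0, by rintro _ ⟨w, rfl⟩; exact norm_nonneg _⟩ (⟨p, hp⟩ : S))
    rw [norm_sub_rev z p, norm_sub_rev z w]
    exact hmin w w.2
  have hinner := (norm_eq_iInf_iff_real_inner_le_zero hS hp).1 hinf v hv
  have hexp : ‖z - v‖ ^ 2 = ‖z - p‖ ^ 2 - 2 * inner ℝ (z - p) (v - p) + ‖p - v‖ ^ 2 := by
    rw [show z - v = (z - p) - (v - p) by abel, norm_sub_sq_real, norm_sub_rev v p]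
  refine le_of_pow_le_pow_left₀ two_ne_zero (norm_nonneg _) ?_
  nlinarith [sq_nonneg ‖z - p‖]

variable {S : Set E} {D G η : ℝ} {proj : E → E} {y g v : ℕ → E}

theorem projected_gradient_inner_le (hS : Convex ℝ S)
    (hproj : ∀ z, proj z ∈ S ∧ ∀ z' ∈ S, ‖proj z - z‖ ≤ ‖z' - z‖) (η : ℝ) (a b c : E)
    (hc : c ∈ S) : 2 * η * inner ℝ b (a - c) + ‖proj (a - η • b) - c‖ ^ 2
      ≤ ‖a - c‖ ^ 2 + η ^ 2 * ‖b‖ ^ 2 := by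
  have h1 := norm_sub_le_of_isNearest hS (hproj (a - η • b)).1 (hproj (a - η • b)).2 hc
  have h2 : ‖a - η • b - c‖ ^ 2
      = ‖a - c‖ ^ 2 - 2 * η * inner ℝ b (a - c) + η ^ 2 * ‖b‖ ^ 2 := by
    rw [show a - η • b - c = (a - c) - η • b by abel, norm_sub_sq_real, norm_smul, mul_pow,
      inner_smul_right, real_inner_comm, Real.norm_eq_abs, sq_abs]
    ring
  have h3 := pow_le_pow_left₀ (norm_nonneg _) h1 2
  linarith

theorem sum_inner_add_sq_le (hS : Convex ℝ S) (hdiam : ∀ z ∈ S, ∀ z' ∈ S, ‖z - z'‖ ≤ D)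
    (hproj : ∀ z, proj z ∈ S ∧ ∀ z' ∈ S, ‖proj z - z‖ ≤ ‖z' - z‖)
    (hy : ∀ t, 1 ≤ t → y t ∈ S) (hg : ∀ t, 1 ≤ t → ‖g t‖ ≤ G)
    (hup : ∀ t, 1 ≤ t → y (t + 1) = proj (y t - η • g t)) {s : ℕ} (hs : 1 ≤ s)
    (hv : ∀ t, 1 ≤ t → t ≤ s → v t ∈ S) :
    2 * η * ∑ t ∈ Finset.Icc 1 s, inner ℝ (g t) (y t - v t) + ‖y (s + 1) - v s‖ ^ 2
      ≤ D ^ 2 + η ^ 2 * G ^ 2 * s + 2 * D * ∑ t ∈ Finset.Ico 1 s, ‖v (t + 1) - v t‖ := by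
  have step : ∀ t, 1 ≤ t → t ≤ s →
      2 * η * inner ℝ (g t) (y t - v t) + ‖y (t + 1) - v t‖ ^ 2
        ≤ ‖y t - v t‖ ^ 2 + η ^ 2 * G ^ 2 := by
    intro t ht hts
    have h1 := projected_gradient_inner_le hS hproj η (y t) (g t) (v t) (hv t ht hts)
    rw [← hup t ht] at h1
    have h2 := mul_le_mul_of_nonneg_left (pow_le_pow_left₀ (norm_nonneg _) (hg t ht) 2)
      (sq_nonneg η)
    linarith
  induction s, hs using Nat.le_induction with
  | base =>
    have h1 := step 1 le_rfl le_rfl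
    have h2 := pow_le_pow_left₀ (norm_nonneg _)
      (hdiam _ (hy 1 le_rfl) _ (hv 1 le_rfl le_rfl)) 2
    simp only [Finset.Icc_self, Finset.sum_singleton, Finset.Ico_self, Finset.sum_empty,
      Nat.cast_one]
    linarith
  | succ n hn ih =>
    have h1 := step (n + 1) (by omega) le_rfl
    have h2 := ih (fun t h h' => hv t h (by omega)) (fun t h h' => step t h (by omega))
    have ha := hdiam _ (hy (n + 1) (by omega)) _ (hv n hn (by omega))
    have hb := hdiam _ (hy (n + 1) (by omega)) _ (hv (n + 1) (by omega) le_rfl)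
    have htri : ‖y (n + 1) - v (n + 1)‖ ≤ ‖y (n + 1) - v n‖ + ‖v (n + 1) - v n‖ := by
      rw [norm_sub_rev (v (n + 1)) (v n)]
      exact norm_sub_le_norm_sub_add_norm_sub _ _ _
    have h3 : ‖y (n + 1) - v (n + 1)‖ ^ 2
        ≤ ‖y (n + 1) - v n‖ ^ 2 + 2 * D * ‖v (n + 1) - v n‖ := by
      have h4 : (‖y (n + 1) - v (n + 1)‖ - ‖y (n + 1) - v n‖)
            * (‖y (n + 1) - v (n + 1)‖ + ‖y (n + 1) - v n‖)
          ≤ ‖v (n + 1) - v n‖ * (D + D) := by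
        refine mul_le_mul (by linarith) (by linarith) (by positivity) (norm_nonneg _)
      nlinarith
    rw [Finset.sum_Icc_succ_top (by omega), Finset.sum_Ico_succ_top hn]
    push_cast
    linarith

/-- Dynamic regret of projected online gradient descent tuned for a length `m` between half the
horizon and the horizon. -/
theorem sum_inner_le_of_path_le (hS : Convex ℝ S) (hdiam : ∀ z ∈ S, ∀ z' ∈ S, ‖z - z'‖ ≤ D)
    (hproj : ∀ z, proj z ∈ S ∧ ∀ z' ∈ S, ‖proj z - z‖ ≤ ‖z' - z‖)
    (hy : ∀ t, 1 ≤ t → y t ∈ S) (hg : ∀ t, 1 ≤ t → ‖g t‖ ≤ G) {m : ℝ} (hm : 0 < m)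
    (hup : ∀ t, 1 ≤ t → y (t + 1) = proj (y t - (D / (G * √m)) • g t)) {T : ℕ} (hT : 1 ≤ T)
    (hmT : m ≤ T) (hTm : T ≤ 2 * m) (hv : ∀ t, 1 ≤ t → t ≤ T → v t ∈ S) {P : ℝ}
    (hP : P = ∑ t ∈ Finset.Ico 1 T, ‖v (t + 1) - v t‖) (hPD : P ≤ D) :
    ∑ t ∈ Finset.Icc 1 T, inner ℝ (g t) (y t - v t)
      ≤ ((1 + √2) / 2 * D * G + G * √(D * P)) * √T := by
  have hG : 0 ≤ G := (norm_nonneg _).trans (hg 1 le_rfl)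
  have hP0 : 0 ≤ P := hP ▸ Finset.sum_nonneg fun _ _ => norm_nonneg _
  have hD : 0 ≤ D := hP0.trans hPD
  have hzero : G = 0 ∨ D = 0 → ∑ t ∈ Finset.Icc 1 T, inner ℝ (g t) (y t - v t)
      ≤ ((1 + √2) / 2 * D * G + G * √(D * P)) * √T := by
    intro h
    refine le_trans (Finset.sum_nonpos fun t ht => ?_) (by positivity)
    obtain ⟨ht1, htT⟩ := Finset.mem_Icc.1 ht
    refine (real_inner_le_norm _ _).trans ?_
    have h1 := mul_le_mul (hg t ht1) (hdiam _ (hy t ht1) _ (hv t ht1 htT)) (norm_nonneg _) hG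
    rcases h with h | h <;> simpa [h] using h1
  rcases hG.eq_or_lt with h | hG
  · exact hzero (Or.inl h.symm)
  rcases hD.eq_or_lt with h | hD
  · exact hzero (Or.inr h.symm)
  have hq : 0 < √m := Real.sqrt_pos.2 hm
  have hmain := sum_inner_add_sq_le hS hdiam hproj hy hg hup hT hv
  rw [← hP] at hmain
  have h1 : ∑ t ∈ Finset.Icc 1 T, inner ℝ (g t) (y t - v t)
      ≤ D * G / 2 * √m + D * G / 2 * (T / √m) + P * G * √m := by
    rw [← mul_le_mul_iff_of_pos_left (show 0 < 2 * (D / (G * √m)) by positivity)]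
    have h0 : 2 * (D / (G * √m)) * (D * G / 2 * √m + D * G / 2 * (T / √m) + P * G * √m)
        = D ^ 2 + (D / (G * √m)) ^ 2 * G ^ 2 * T + 2 * D * P := by
      field_simp
    rw [h0]
    linarith [sq_nonneg ‖y (T + 1) - v T‖]
  have h2 : √m ≤ √T := Real.sqrt_le_sqrt hmT
  have h3 : T / √m ≤ √2 * √T := by
    rw [div_le_iff₀ hq]
    have h4 : √(T : ℝ) ≤ √2 * √m := by
      rw [← Real.sqrt_mul (by norm_num)]
      exact Real.sqrt_le_sqrt hTm
    calc (T : ℝ) = √T * √T := (Real.mul_self_sqrt (by positivity)).symm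
      _ ≤ √T * (√2 * √m) := by gcongr
      _ = _ := by ring
  have h4 : P ≤ √(D * P) := Real.le_sqrt_of_sq_le (by nlinarith)
  calc _ ≤ _ := h1
    _ ≤ D * G / 2 * √T + D * G / 2 * (√2 * √T) + √(D * P) * G * √T := by gcongr
    _ = _ := by ring

end OnlineGradientDescent

/-- Lemma 5: under the AOD algorithm with horizon `T`, if the
path-length `P_T` of the comparator sequence `u` satisfies `P_T ≤ D`, then the
dynamic regret is at most `(((1+√2)/2)DG + G√(DP_T) + √(6c(T)))·√T`. -/
theorem aod_dynamic_regret_small_path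
    (d T : ℕ) (hT : 1 ≤ T) (D G : ℝ)
    (Ω : Set (EuclideanSpace ℝ (Fin d)))
    (hne : Ω.Nonempty) (hcomp : IsCompact Ω) (hconv : Convex ℝ Ω)
    (hdiam : ∀ z ∈ Ω, ∀ z' ∈ Ω, ‖z - z'‖ ≤ D)
    (f : ℕ → EuclideanSpace ℝ (Fin d) → ℝ)
    (hfconv : ∀ t, ConvexOn ℝ Set.univ (f t))
    (hfdiff : ∀ t z, DifferentiableAt ℝ (f t) z)
    (hgrad : ∀ t, ∀ z ∈ Ω, ‖gradient (f t) z‖ ≤ G)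
    (hrange : ∀ t, ∀ z ∈ Ω, 0 ≤ f t z ∧ f t z ≤ 1)
    (proj : EuclideanSpace ℝ (Fin d) → EuclideanSpace ℝ (Fin d))
    (hproj : ∀ z, proj z ∈ Ω ∧ ∀ z' ∈ Ω, ‖proj z - z‖ ≤ ‖z' - z‖)
    (x : ℕ → ℕ → EuclideanSpace ℝ (Fin d))
    (hx1 : ∀ k, x k 1 ∈ Ω)
    (hxup : ∀ k t, 1 ≤ t →
      x k (t + 1) = proj (x k t - (D / (G * Real.sqrt ((2 : ℝ) ^ k))) • gradient (f t) (x k t)))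
    (w : ℕ → EuclideanSpace ℝ (Fin d))
    (hw : ∀ t, 1 ≤ t → w t = ∑ k ∈ dgcLevels T, aodWeight T f w x k t • x k t)
    (u : ℕ → EuclideanSpace ℝ (Fin d))
    (hu : ∀ t, 1 ≤ t → t ≤ T → u t ∈ Ω)
    (P : ℝ) (hP : P = ∑ t ∈ Finset.Ico 1 T, ‖u (t + 1) - u t‖)
    (hPD : P ≤ D) :
    ∑ t ∈ Finset.Icc 1 T, f t (w t) - ∑ t ∈ Finset.Icc 1 T, f t (u t)
      ≤ ((1 + Real.sqrt 2) / 2 * D * G + G * Real.sqrt (D * P)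
          + Real.sqrt (6 * cAOD T T)) * Real.sqrt (T : ℝ) := by
  have hx : ∀ k t, 1 ≤ t → x k t ∈ Ω := by
    intro k t ht
    induction t, ht using Nat.le_induction with
    | base => exact hx1 k
    | succ n hn _ => exact hxup k n hn ▸ (hproj _).1
  have hwmem : ∀ t, 1 ≤ t → w t ∈ Ω := by
    intro t ht
    rw [hw t ht]
    exact hconv.sum_mem (fun k _ => aodWeight_nonneg f w x T k t) (sum_aodWeight f w x hT ht)
      fun k _ => hx k t ht
  have hmeta := sum_sub_top_level_le f w x hT
    (fun k t ht _ => abs_sub_le_of_nonneg_of_le (hrange t _ (hwmem t ht)).1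
      (hrange t _ (hwmem t ht)).2 (hrange t _ (hx k t ht)).1 (hrange t _ (hx k t ht)).2)
    (fun t ht _ => sum_anhW_mul_nonpos hT ht (hfconv t) (hw t ht))
  set K := Nat.log 2 T with hK
  have hle : ((2 : ℝ) ^ K) ≤ T := by exact_mod_cast Nat.pow_log_le_self 2 (by omega)
  have hlt : (T : ℝ) ≤ 2 * (2 : ℝ) ^ K := by
    rw [← pow_succ']
    exact_mod_cast (Nat.lt_pow_succ_log_self (by norm_num) T).le
  have hogd := sum_inner_le_of_path_le hconv hdiam hproj (hx K)
    (g := fun t => gradient (f t) (x K t)) (fun t ht => hgrad t _ (hx K t ht))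
    (by positivity) (hxup K) hT hle hlt hu hP hPD
  have hexpert : ∑ t ∈ Finset.Icc 1 T, (f t (x K t) - f t (u t))
      ≤ ∑ t ∈ Finset.Icc 1 T, inner ℝ (gradient (f t) (x K t)) (x K t - u t) :=
    Finset.sum_le_sum fun t _ => (hfconv t).sub_le_inner_gradient (hfdiff t _) (u t)
  rw [Finset.sum_sub_distrib] at hmeta hexpert
  rw [add_mul]
  linarith
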